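/- Let p, q be probability vectors on Fin d with p ≠ q whose entries are decreasingly ordered (p i ≥ p j and q i ≥ q j whenever i ≤ j). Then the following are equivalent: (a) there exist m₁, m₂, m₃ ≥ 1 and a probability distribution r on Fin m₁ × Fin m₂ × Fin m₃ such that p ⊗ r ≺ q ⊗ (r₁ ⊗ r₂ ⊗ r₃), where r₁, r₂, r₃ are the marginals of r; (b) the number of indices i with q i ≠ 0 is at most the number of indices i with p i ≠ 0, and H(q) < H(p). -/

import Mathlib

open Finset

/-- max over finsets of card k of the sum of entries -/
noncomputable def maxSum {ι : Type*} [Fintype ι] (p : ι → ℝ) (k : ℕ) : ℝ :=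
  sSup {x : ℝ | ∃ S : Finset ι, S.card = k ∧ x = ∑ i ∈ S, p i}

/-- majorization: equal total sums, and for each k the max k-term partial sum
of `p` is at most that of `q`. -/
def Maj {ι : Type*} [Fintype ι] (p q : ι → ℝ) : Prop :=
  (∑ i, p i = ∑ i, q i) ∧ ∀ k : ℕ, maxSum p k ≤ maxSum q k

/-- a probability vector: nonnegative entries summing to one -/
def IsProbVec {ι : Type*} [Fintype ι] (p : ι → ℝ) : Prop :=
  (∀ i, 0 ≤ p i) ∧ ∑ i, p i = 1

/-- tensor product of two vectors -/
def tensor {ι κ : Type*} (p : ι → ℝ) (r : κ → ℝ) : ι × κ → ℝ :=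
  fun x => p x.1 * r x.2

/-- Shannon entropy (with `0 * log 0 = 0` automatic since `Real.log 0 = 0`) -/
noncomputable def shannon {ι : Type*} [Fintype ι] (p : ι → ℝ) : ℝ :=
  -∑ i, p i * Real.log (p i)

/-- first marginal of a tripartite distribution -/
noncomputable def marg₁ {m₁ m₂ m₃ : ℕ} (r : Fin m₁ × Fin m₂ × Fin m₃ → ℝ) : Fin m₁ → ℝ :=
  fun i => ∑ j, ∑ k, r (i, j, k)

/-- second marginal of a tripartite distribution -/
noncomputable def marg₂ {m₁ m₂ m₃ : ℕ} (r : Fin m₁ × Fin m₂ × Fin m₃ → ℝ) : Fin m₂ → ℝ :=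
  fun j => ∑ i, ∑ k, r (i, j, k)

/-- third marginal of a tripartite distribution -/
noncomputable def marg₃ {m₁ m₂ m₃ : ℕ} (r : Fin m₁ × Fin m₂ × Fin m₃ → ℝ) : Fin m₃ → ℝ :=
  fun k => ∑ i, ∑ j, r (i, j, k)

/-- product of the three marginals of a tripartite distribution -/
noncomputable def prodMarg {m₁ m₂ m₃ : ℕ} (r : Fin m₁ × Fin m₂ × Fin m₃ → ℝ) :
    Fin m₁ × Fin m₂ × Fin m₃ → ℝ :=
  fun x => marg₁ r x.1 * (marg₂ r x.2.1 * marg₃ r x.2.2)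


/-! ### Majorization through hinge sums -/

/-- The sum of the positive parts of `f i - t`. -/
noncomputable def hinge {α : Type*} [Fintype α] (f : α → ℝ) (t : ℝ) : ℝ :=
  ∑ i, max (f i - t) 0

lemma sum_le_maxSum {α : Type*} [Fintype α] (f : α → ℝ) (S : Finset α) :
    ∑ i ∈ S, f i ≤ maxSum f S.card := by
  refine le_csSup (Set.Finite.bddAbove ?_) ⟨S, rfl, rfl⟩
  refine (Set.finite_range (fun S : Finset α => ∑ i ∈ S, f i)).subset ?_
  rintro x ⟨S, -, rfl⟩
  exact ⟨S, rfl⟩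

lemma exists_maxSum_eq {α : Type*} [Fintype α] (f : α → ℝ) {k : ℕ} (hk : k ≤ Fintype.card α) :
    ∃ S : Finset α, S.card = k ∧ maxSum f k = ∑ i ∈ S, f i := by
  have hne : {x : ℝ | ∃ S : Finset α, S.card = k ∧ x = ∑ i ∈ S, f i}.Nonempty := by
    obtain ⟨S, -, hS⟩ := Finset.exists_subset_card_eq (s := (univ : Finset α)) (n := k) (by simpa)
    exact ⟨_, S, hS, rfl⟩
  refine hne.csSup_mem ?_
  refine (Set.finite_range (fun S : Finset α => ∑ i ∈ S, f i)).subset ?_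
  rintro x ⟨S, -, rfl⟩
  exact ⟨S, rfl⟩

lemma sum_sub_card_mul_le_hinge {α : Type*} [Fintype α] (f : α → ℝ) (S : Finset α) (t : ℝ) :
    ∑ i ∈ S, f i - S.card * t ≤ hinge f t := by
  calc ∑ i ∈ S, f i - S.card * t = ∑ i ∈ S, (f i - t) := by simp [sum_sub_distrib]
    _ ≤ ∑ i ∈ S, max (f i - t) 0 := sum_le_sum fun i _ => le_max_left _ _
    _ ≤ hinge f t := sum_le_sum_of_subset_of_nonneg (subset_univ _) fun i _ _ => le_max_right _ _

lemma Maj.hinge_le {α : Type*} [Fintype α] {f g : α → ℝ} (h : Maj f g) (t : ℝ) :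
    hinge f t ≤ hinge g t := by
  classical
  set S : Finset α := univ.filter fun i => t < f i
  have h1 : hinge f t = ∑ i ∈ S, f i - S.card * t := by
    have : hinge f t = ∑ i ∈ S, (f i - t) := by
      rw [hinge, sum_filter]
      refine sum_congr rfl fun i _ => ?_
      split_ifs with hi
      · exact max_eq_left (by linarith)
      · exact max_eq_right (by linarith)
    simp [this, sum_sub_distrib]
  obtain ⟨T, hT, hT'⟩ := exists_maxSum_eq g (k := S.card) (card_le_univ S)
  have h2 := sum_sub_card_mul_le_hinge g T t
  have h3 := h.2 S.card
  have h4 := sum_le_maxSum f S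
  rw [hT] at h2
  linarith

lemma exists_hinge_eq_maxSum {α : Type*} [Fintype α] (g : α → ℝ) {k : ℕ} (hk : 0 < k)
    (hk' : k ≤ Fintype.card α) : ∃ i, maxSum g k = hinge g (g i) + k * g i := by
  classical
  obtain ⟨S, hS, hS'⟩ := exists_maxSum_eq g hk'
  have hne : S.Nonempty := card_pos.1 (by omega)
  obtain ⟨i, hi, hmin⟩ := S.exists_min_image g hne
  refine ⟨i, ?_⟩
  have hout : ∀ j, j ∉ S → g j ≤ g i := by
    intro j hj
    have h1 := sum_le_maxSum g (insert j (S.erase i))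
    have hj' : j ∉ S.erase i := fun h => hj (mem_of_mem_erase h)
    rw [card_insert_of_notMem hj', card_erase_of_mem hi, Nat.sub_add_cancel (by omega), hS, hS',
      sum_insert hj'] at h1
    have := add_sum_erase S g hi
    linarith
  have : hinge g (g i) = ∑ j ∈ S, (g j - g i) := by
    rw [hinge, ← sum_subset (subset_univ S)]
    · exact sum_congr rfl fun j hj => max_eq_left (by linarith [hmin j hj])
    · exact fun j _ hj => max_eq_right (by linarith [hout j hj])
  rw [this, hS', sum_sub_distrib]
  simp [hS]

lemma maj_of_hinge_le {α : Type*} [Fintype α] {f g : α → ℝ} (hsum : ∑ i, f i = ∑ i, g i)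
    (hg : ∀ i, 0 ≤ g i) (h : ∀ t, 0 ≤ t → hinge f t ≤ hinge g t) : Maj f g := by
  refine ⟨hsum, fun k => ?_⟩
  rcases Nat.eq_zero_or_pos k with rfl | hk
  · simp [maxSum]
  by_cases hk' : k ≤ Fintype.card α
  · obtain ⟨i, hi⟩ := exists_hinge_eq_maxSum g hk hk'
    obtain ⟨S, hS, hS'⟩ := exists_maxSum_eq f hk'
    have h1 := sum_sub_card_mul_le_hinge f S (g i)
    have h2 := h (g i) (hg i)
    rw [hS] at h1
    linarith
  · have : ∀ S : Finset α, S.card ≠ k := fun S hS => hk' (hS ▸ card_le_univ S)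
    simp [maxSum, this]

/-! ### Convex sums and entropy under majorization -/

lemma eq_add_integral_hinge {φ φ' φ'' : ℝ → ℝ} {a b x : ℝ} (hx : x ∈ Set.Icc a b)
    (h1 : ∀ y ∈ Set.Icc a b, HasDerivAt φ (φ' y) y)
    (h2 : ∀ y ∈ Set.Icc a b, HasDerivAt φ' (φ'' y) y)
    (h3 : ContinuousOn φ'' (Set.Icc a b)) :
    φ x = φ a + φ' a * (x - a) + ∫ t in a..b, max (x - t) 0 * φ'' t := by
  have hab : a ≤ b := hx.1.trans hx.2
  have hcont : ContinuousOn (fun t => max (x - t) 0 * φ'' t) (Set.Icc a b) := by fun_prop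
  have hint : ∀ c ∈ Set.Icc a b, ∀ e ∈ Set.Icc a b,
      IntervalIntegrable (fun t => max (x - t) 0 * φ'' t) MeasureTheory.volume c e :=
    fun c hc e he => (hcont.mono (Set.uIcc_subset_Icc hc he)).intervalIntegrable
  have ha : a ∈ Set.Icc a b := ⟨le_rfl, hab⟩
  have hb : b ∈ Set.Icc a b := ⟨hab, le_rfl⟩
  rw [← intervalIntegral.integral_add_adjacent_intervals (hint a ha x hx) (hint x hx b hb)]
  have e2 : ∫ t in x..b, max (x - t) 0 * φ'' t = 0 := by
    rw [← intervalIntegral.integral_zero (a := x) (b := b) (μ := MeasureTheory.volume)]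
    refine intervalIntegral.integral_congr fun t ht => ?_
    rw [Set.uIcc_of_le hx.2] at ht
    simp [max_eq_right (show x - t ≤ 0 by linarith [ht.1])]
  have e1 : ∫ t in a..x, max (x - t) 0 * φ'' t = ∫ t in a..x, (x - t) * φ'' t := by
    refine intervalIntegral.integral_congr fun t ht => ?_
    rw [Set.uIcc_of_le hx.1] at ht
    simp [max_eq_left (show 0 ≤ x - t by linarith [ht.2])]
  have e3 : ∫ t in a..x, (x - t) * φ'' t
      = ((x - x) * φ' x + φ x) - ((x - a) * φ' a + φ a) := by
    refine intervalIntegral.integral_eq_sub_of_hasDerivAt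
      (f := fun t => (x - t) * φ' t + φ t) (fun t ht => ?_) ?_
    · rw [Set.uIcc_of_le hx.1] at ht
      have ht' : t ∈ Set.Icc a b := ⟨ht.1, ht.2.trans hx.2⟩
      have := (((hasDerivAt_id t).const_sub x).mul (h2 t ht')).add (h1 t ht')
      refine this.congr_deriv ?_
      simp
    · refine ContinuousOn.intervalIntegrable ?_
      have := h3.mono (Set.uIcc_subset_Icc ha hx)
      fun_prop
  rw [e2, e1, e3]
  ring

lemma sum_convex_le_of_hinge_le {α : Type*} [Fintype α] {f g : α → ℝ}
    (hsum : ∑ i, f i = ∑ i, g i) (h : ∀ t, hinge f t ≤ hinge g t)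
    {φ φ' φ'' : ℝ → ℝ} {a b : ℝ} (hab : a ≤ b)
    (hf : ∀ i, f i ∈ Set.Icc a b) (hg : ∀ i, g i ∈ Set.Icc a b)
    (h1 : ∀ y ∈ Set.Icc a b, HasDerivAt φ (φ' y) y)
    (h2 : ∀ y ∈ Set.Icc a b, HasDerivAt φ' (φ'' y) y)
    (h3 : ContinuousOn φ'' (Set.Icc a b)) (h4 : ∀ y ∈ Set.Icc a b, 0 ≤ φ'' y) :
    ∑ i, φ (f i) ≤ ∑ i, φ (g i) := by
  have hint : ∀ x : ℝ, IntervalIntegrable (fun t => max (x - t) 0 * φ'' t)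
      MeasureTheory.volume a b := by
    intro x
    refine ContinuousOn.intervalIntegrable ?_
    rw [Set.uIcc_of_le hab]
    fun_prop
  have key : ∀ u : α → ℝ, (∀ i, u i ∈ Set.Icc a b) →
      ∑ i, φ (u i) = ∑ _i : α, φ a + φ' a * (∑ i, u i - ∑ _i : α, a)
        + ∫ t in a..b, hinge u t * φ'' t := by
    intro u hu
    simp only [hinge, sum_mul]
    rw [intervalIntegral.integral_finsetSum (fun i _ => hint (u i)), ← sum_sub_distrib, mul_sum,
      ← sum_add_distrib, ← sum_add_distrib]
    exact sum_congr rfl fun i _ => eq_add_integral_hinge (hu i) h1 h2 h3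
  rw [key f hf, key g hg, hsum]
  have hc : ∀ u : α → ℝ, IntervalIntegrable (fun t => hinge u t * φ'' t)
      MeasureTheory.volume a b := by
    intro u
    refine ContinuousOn.intervalIntegrable ?_
    rw [Set.uIcc_of_le hab]
    unfold hinge
    fun_prop
  have := intervalIntegral.integral_mono_on hab (hc f) (hc g)
    fun t ht => mul_le_mul_of_nonneg_right (h t) (h4 t ht)
  linarith

lemma IsProbVec.le_one {α : Type*} [Fintype α] {f : α → ℝ} (hf : IsProbVec f) (i : α) :
    f i ≤ 1 := by
  rw [← hf.2]
  exact single_le_sum (fun j _ => hf.1 j) (mem_univ i)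

lemma sum_pow_le_of_hinge_le {α : Type*} [Fintype α] {f g : α → ℝ}
    (hf : IsProbVec f) (hg : IsProbVec g) (h : ∀ t, hinge f t ≤ hinge g t) (j : ℕ) :
    ∑ i, f i ^ (j + 2) ≤ ∑ i, g i ^ (j + 2) := by
  refine sum_convex_le_of_hinge_le (hf.2.trans hg.2.symm) h (zero_le_one (α := ℝ))
    (φ := fun x => x ^ (j + 2))
    (φ' := fun x => ((j + 2 : ℕ) : ℝ) * x ^ (j + 1))
    (φ'' := fun x => ((j + 2 : ℕ) : ℝ) * (((j + 1 : ℕ) : ℝ) * x ^ j))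
    (fun i => ⟨hf.1 i, hf.le_one i⟩) (fun i => ⟨hg.1 i, hg.le_one i⟩)
    (fun y _ => hasDerivAt_pow (j + 2) y)
    (fun y _ => (hasDerivAt_pow (j + 1) y).const_mul _) (by fun_prop) ?_
  intro y hy
  have := hy.1
  positivity

lemma sum_mul_log_sub_pow_le_of_hinge_le {α : Type*} [Fintype α] {f g : α → ℝ}
    (hf : IsProbVec f) (hg : IsProbVec g) (h : ∀ t, hinge f t ≤ hinge g t) (j : ℕ) :
    ∃ c : ℝ, 0 < c ∧ ∑ i, (f i * Real.log (f i) - c * f i ^ (j + 2)) ≤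
      ∑ i, (g i * Real.log (g i) - c * g i ^ (j + 2)) := by
  set c : ℝ := 1 / (((j + 2 : ℕ) : ℝ) * (((j + 1 : ℕ) : ℝ) * 2 ^ (j + 1))) with hc
  have hcpos : 0 < c := by positivity
  refine ⟨c, hcpos, ?_⟩
  set φ : ℝ → ℝ := fun x => x * Real.log x - c * x ^ (j + 2) with hφ
  have hφc : Continuous φ := by
    have := Real.continuous_mul_log
    fun_prop
  have step : ∀ ε ∈ Set.Ioo (0 : ℝ) 1, ∑ i, φ (f i + ε) ≤ ∑ i, φ (g i + ε) := by
    intro ε hε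
    refine sum_convex_le_of_hinge_le (f := fun i => f i + ε) (g := fun i => g i + ε)
      (by simp [sum_add_distrib, hf.2, hg.2]) ?_ (a := ε) (b := 2) (by linarith [hε.2])
      (fun i => ⟨by linarith [hf.1 i], by linarith [hf.le_one i, hε.2]⟩)
      (fun i => ⟨by linarith [hg.1 i], by linarith [hg.le_one i, hε.2]⟩)
      (φ' := fun x => Real.log x + 1 - c * (((j + 2 : ℕ) : ℝ) * x ^ (j + 1)))
      (φ'' := fun x => x⁻¹ - c * (((j + 2 : ℕ) : ℝ) * (((j + 1 : ℕ) : ℝ) * x ^ j))) ?_ ?_ ?_ ?_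
    · intro t
      convert h (t - ε) using 1 <;> simp only [hinge] <;>
        exact sum_congr rfl fun i _ => by ring_nf
    · intro y hy
      have hy0 : y ≠ 0 := by linarith [hy.1, hε.1]
      exact (Real.hasDerivAt_mul_log hy0).sub ((hasDerivAt_pow (j + 2) y).const_mul c)
    · intro y hy
      have hy0 : y ≠ 0 := by linarith [hy.1, hε.1]
      exact ((Real.hasDerivAt_log hy0).add_const 1).sub
        (((hasDerivAt_pow (j + 1) y).const_mul _).const_mul c)
    · refine ContinuousOn.sub (continuousOn_inv₀.mono ?_) (by fun_prop)
      intro y hy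
      simp only [Set.mem_compl_iff, Set.mem_singleton_iff]
      linarith [hy.1, hε.1]
    · intro y hy
      have hy0 : 0 < y := by linarith [hy.1, hε.1]
      have hpow : y ^ (j + 1) ≤ 2 ^ (j + 1) := pow_le_pow_left₀ hy0.le hy.2 _
      have : c * (((j + 2 : ℕ) : ℝ) * (((j + 1 : ℕ) : ℝ) * y ^ (j + 1))) ≤ 1 := by
        rw [hc, one_div_mul_eq_div, div_le_one (by positivity)]
        gcongr
      rw [sub_nonneg, ← one_div, le_div_iff₀ hy0]
      refine le_trans (le_of_eq ?_) this
      ring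
  have lim : ∀ u : α → ℝ, Filter.Tendsto (fun ε => ∑ i, φ (u i + ε)) (nhdsWithin 0 (Set.Ioi 0))
      (nhds (∑ i, φ (u i))) := by
    intro u
    have : Continuous fun ε => ∑ i, φ (u i + ε) := by fun_prop
    have h0 := this.tendsto 0
    simp only [add_zero] at h0
    exact h0.mono_left nhdsWithin_le_nhds
  refine le_of_tendsto_of_tendsto (lim f) (lim g) ?_
  filter_upwards [Ioo_mem_nhdsGT (zero_lt_one (α := ℝ))] with ε hε using step ε hε

lemma shannon_le_of_hinge_le {α : Type*} [Fintype α] {f g : α → ℝ}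
    (hf : IsProbVec f) (hg : IsProbVec g) (h : ∀ t, hinge f t ≤ hinge g t) :
    shannon g ≤ shannon f ∧
      (shannon g = shannon f → ∀ j : ℕ, ∑ i, f i ^ (j + 2) = ∑ i, g i ^ (j + 2)) := by
  have key : ∀ j : ℕ, ∃ c : ℝ, 0 < c ∧ shannon g ≤ shannon f -
      c * (∑ i, g i ^ (j + 2) - ∑ i, f i ^ (j + 2)) := by
    intro j
    obtain ⟨c, hc, hle⟩ := sum_mul_log_sub_pow_le_of_hinge_le hf hg h j
    refine ⟨c, hc, ?_⟩
    simp only [sum_sub_distrib, ← mul_sum] at hle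
    simp only [shannon]
    linarith
  refine ⟨?_, fun heq j => ?_⟩
  · obtain ⟨c, hc, hle⟩ := key 0
    nlinarith [sum_pow_le_of_hinge_le hf hg h 0]
  · obtain ⟨c, hc, hle⟩ := key j
    nlinarith [sum_pow_le_of_hinge_le hf hg h j]

lemma IsProbVec.tensor {α β : Type*} [Fintype α] [Fintype β] {f : α → ℝ} {g : β → ℝ}
    (hf : IsProbVec f) (hg : IsProbVec g) : IsProbVec (tensor f g) := by
  refine ⟨fun x => mul_nonneg (hf.1 _) (hg.1 _), ?_⟩
  simp only [_root_.tensor, Fintype.sum_prod_type, ← mul_sum, hg.2, hf.2, mul_one]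

lemma shannon_tensor {α β : Type*} [Fintype α] [Fintype β] {f : α → ℝ} {g : β → ℝ}
    (hf : IsProbVec f) (hg : IsProbVec g) : shannon (tensor f g) = shannon f + shannon g := by
  have h : ∀ a b : ℝ, a * b * Real.log (a * b) = b * (a * Real.log a) + a * (b * Real.log b) := by
    intro a b
    rcases eq_or_ne a 0 with rfl | ha
    · simp
    rcases eq_or_ne b 0 with rfl | hb
    · simp
    rw [Real.log_mul ha hb]
    ring
  simp only [shannon, tensor, Fintype.sum_prod_type, h, sum_add_distrib, ← mul_sum, ← sum_mul,
    hf.2, hg.2]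
  ring

lemma IsProbVec.marg₁ {m₁ m₂ m₃ : ℕ} {r : Fin m₁ × Fin m₂ × Fin m₃ → ℝ} (hr : IsProbVec r) :
    IsProbVec (marg₁ r) :=
  ⟨fun _ => sum_nonneg fun _ _ => sum_nonneg fun _ _ => hr.1 _, by
    simp only [_root_.marg₁, ← hr.2, Fintype.sum_prod_type]⟩

lemma IsProbVec.marg₂ {m₁ m₂ m₃ : ℕ} {r : Fin m₁ × Fin m₂ × Fin m₃ → ℝ} (hr : IsProbVec r) :
    IsProbVec (marg₂ r) := by
  refine ⟨fun _ => sum_nonneg fun _ _ => sum_nonneg fun _ _ => hr.1 _, ?_⟩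
  simp only [_root_.marg₂, ← hr.2, Fintype.sum_prod_type]
  rw [sum_comm]

lemma IsProbVec.marg₃ {m₁ m₂ m₃ : ℕ} {r : Fin m₁ × Fin m₂ × Fin m₃ → ℝ} (hr : IsProbVec r) :
    IsProbVec (marg₃ r) := by
  refine ⟨fun _ => sum_nonneg fun _ _ => sum_nonneg fun _ _ => hr.1 _, ?_⟩
  simp only [_root_.marg₃, ← hr.2, Fintype.sum_prod_type]
  rw [sum_comm]
  exact sum_congr rfl fun i _ => sum_comm

lemma IsProbVec.prodMarg {m₁ m₂ m₃ : ℕ} {r : Fin m₁ × Fin m₂ × Fin m₃ → ℝ}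
    (hr : IsProbVec r) : IsProbVec (prodMarg r) :=
  hr.marg₁.tensor (hr.marg₂.tensor hr.marg₃)

/-- Gibbs' inequality, with its equality case. -/
lemma shannon_le_cross_entropy {α : Type*} [Fintype α] {f g : α → ℝ}
    (hf : IsProbVec f) (hg : IsProbVec g) (hfg : ∀ i, g i = 0 → f i = 0) :
    shannon f ≤ -∑ i, f i * Real.log (g i) ∧
      (shannon f = -∑ i, f i * Real.log (g i) → f = g) := by
  have h : ∀ i, g i * InformationTheory.klFun (f i / g i) =
      f i * Real.log (f i) - f i * Real.log (g i) + (g i - f i) := by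
    intro i
    rcases eq_or_ne (g i) 0 with h0 | h0
    · simp [h0, hfg i h0]
    rcases eq_or_ne (f i) 0 with h1 | h1
    · simp [h1, InformationTheory.klFun]
    rw [InformationTheory.klFun, Real.log_div h1 h0]
    field_simp
    ring
  have hnn : ∀ i, 0 ≤ g i * InformationTheory.klFun (f i / g i) := fun i =>
    mul_nonneg (hg.1 i) (InformationTheory.klFun_nonneg (div_nonneg (hf.1 i) (hg.1 i)))
  have hs : ∑ i, g i * InformationTheory.klFun (f i / g i) =
      -shannon f - ∑ i, f i * Real.log (g i) := by
    simp only [h, sum_add_distrib, sum_sub_distrib, hf.2, hg.2, shannon]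
    ring
  refine ⟨by linarith [sum_nonneg fun i (_ : i ∈ univ) => hnn i], fun heq => ?_⟩
  rw [heq, neg_neg, sub_self, sum_eq_zero_iff_of_nonneg fun i _ => hnn i] at hs
  funext i
  rcases mul_eq_zero.1 (hs i (mem_univ i)) with h0 | h0
  · rw [h0, hfg i h0]
  · rw [InformationTheory.klFun_eq_zero_iff (div_nonneg (hf.1 i) (hg.1 i))] at h0
    exact eq_of_div_eq_one h0

lemma eq_zero_of_prodMarg_eq_zero {m₁ m₂ m₃ : ℕ} {r : Fin m₁ × Fin m₂ × Fin m₃ → ℝ}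
    (hr : IsProbVec r) {x : Fin m₁ × Fin m₂ × Fin m₃}
    (hx : marg₁ r x.1 = 0 ∨ marg₂ r x.2.1 = 0 ∨ marg₃ r x.2.2 = 0) : r x = 0 := by
  obtain ⟨i, j, k⟩ := x
  have e : ∀ {β γ : Type} [Fintype β] [Fintype γ] (F : β → γ → ℝ), (∀ b c, 0 ≤ F b c) →
      ∑ b, ∑ c, F b c = 0 → ∀ b c, F b c = 0 := by
    intro β γ _ _ F hF h0 b c
    have h1 := (sum_eq_zero_iff_of_nonneg fun b _ => sum_nonneg fun c _ => hF b c).1 h0 b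
      (mem_univ b)
    exact (sum_eq_zero_iff_of_nonneg fun c _ => hF b c).1 h1 c (mem_univ c)
  rcases hx with h | h | h
  · exact e (fun j k => r (i, j, k)) (fun _ _ => hr.1 _) h j k
  · exact e (fun i k => r (i, j, k)) (fun _ _ => hr.1 _) h i k
  · exact e (fun i j => r (i, j, k)) (fun _ _ => hr.1 _) h i j

/-- Subadditivity of the Shannon entropy, with its equality case. -/
lemma shannon_le_shannon_prodMarg {m₁ m₂ m₃ : ℕ} {r : Fin m₁ × Fin m₂ × Fin m₃ → ℝ}
    (hr : IsProbVec r) : shannon r ≤ shannon (prodMarg r) ∧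
      (shannon r = shannon (prodMarg r) → r = prodMarg r) := by
  have h0 : ∀ x, prodMarg r x = 0 → r x = 0 := fun x hx =>
    eq_zero_of_prodMarg_eq_zero hr (by simpa [prodMarg, mul_eq_zero] using hx)
  have h := shannon_le_cross_entropy hr hr.prodMarg h0
  have hsh : shannon (prodMarg r) = shannon (marg₁ r) + (shannon (marg₂ r) + shannon (marg₃ r)) := by
    rw [← shannon_tensor hr.marg₂ hr.marg₃, ← shannon_tensor hr.marg₁ (hr.marg₂.tensor hr.marg₃)]
    rfl
  have hlog : ∀ x, r x * Real.log (prodMarg r x) = r x * Real.log (marg₁ r x.1) +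
      (r x * Real.log (marg₂ r x.2.1) + r x * Real.log (marg₃ r x.2.2)) := by
    intro x
    by_cases hx : marg₁ r x.1 = 0 ∨ marg₂ r x.2.1 = 0 ∨ marg₃ r x.2.2 = 0
    · simp [eq_zero_of_prodMarg_eq_zero hr hx]
    · push Not at hx
      rw [prodMarg, Real.log_mul hx.1 (mul_ne_zero hx.2.1 hx.2.2), Real.log_mul hx.2.1 hx.2.2]
      ring
  have hcross : -∑ x, r x * Real.log (prodMarg r x) = shannon (prodMarg r) := by
    rw [hsh, sum_congr rfl fun x _ => hlog x, sum_add_distrib, sum_add_distrib]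
    have e1 : ∑ x, r x * Real.log (marg₁ r x.1) = -shannon (marg₁ r) := by
      simp only [shannon, neg_neg, Fintype.sum_prod_type, ← sum_mul]
      rfl
    have e2 : ∑ x, r x * Real.log (marg₂ r x.2.1) = -shannon (marg₂ r) := by
      simp only [shannon, neg_neg, Fintype.sum_prod_type, ← sum_mul]
      rw [sum_comm]
      simp only [← sum_mul]
      rfl
    have e3 : ∑ x, r x * Real.log (marg₃ r x.2.2) = -shannon (marg₃ r) := by
      simp only [shannon, neg_neg, Fintype.sum_prod_type]
      rw [sum_congr rfl fun i _ => sum_comm, sum_comm]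
      simp only [← sum_mul]
      rfl
    rw [e1, e2, e3]
    ring
  rwa [hcross] at h

/-! ### Necessity -/

lemma imp_of_card_filter_le {d : ℕ} {P Q : Fin d → Prop} [DecidablePred P] [DecidablePred Q]
    (hP : ∀ i j, i ≤ j → P j → P i) (hQ : ∀ i j, i ≤ j → Q j → Q i)
    (hcard : (univ.filter Q).card ≤ (univ.filter P).card) {i : Fin d} (hi : Q i) : P i := by
  by_contra hPi
  have h1 : Iic i ⊆ univ.filter Q := fun j hj => by
    simpa using hQ j i (mem_Iic.1 hj) hi
  have h2 : univ.filter P ⊆ Iio i := fun j hj => by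
    rw [mem_Iio]
    by_contra hji
    exact hPi (hP i j (not_lt.1 hji) (by simpa using hj))
  have h3 := card_le_card h1
  have h4 := card_le_card h2
  rw [Fin.card_Iic] at h3
  rw [Fin.card_Iio] at h4
  omega

lemma card_filter_le_eq_of_sum_pow_eq {α : Type*} [Fintype α] {f g : α → ℝ}
    (h : ∀ m : ℕ, ∑ i, f i ^ m = ∑ i, g i ^ m) (v : ℝ) :
    (univ.filter fun i => v ≤ f i).card = (univ.filter fun i => v ≤ g i).card := by
  classical
  have hpoly : ∀ P : Polynomial ℝ, ∑ i, P.eval (f i) = ∑ i, P.eval (g i) := by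
    intro P
    simp only [Polynomial.eval_eq_sum_range]
    rw [sum_comm, sum_comm (s := univ)]
    simp only [← mul_sum, h]
  set s : Finset ℝ := univ.image f ∪ univ.image g
  have hP := hpoly (Lagrange.interpolate s id fun x => if v ≤ x then 1 else 0)
  have hev : ∀ x ∈ s, (Lagrange.interpolate s id fun x => if v ≤ x then 1 else 0).eval x =
      if v ≤ x then (1 : ℝ) else 0 := fun x hx =>
    Lagrange.eval_interpolate_at_node _ Function.injective_id.injOn hx
  rw [sum_congr rfl fun i _ => hev (f i) (by simp [s]),
    sum_congr rfl fun i _ => hev (g i) (by simp [s])] at hP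
  simpa using hP

lemma eq_of_sum_pow_eq {d : ℕ} {p q : Fin d → ℝ} (hp : ∀ i j : Fin d, i ≤ j → p j ≤ p i)
    (hq : ∀ i j : Fin d, i ≤ j → q j ≤ q i) (h : ∀ m : ℕ, ∑ i, p i ^ m = ∑ i, q i ^ m) :
    p = q := by
  funext i
  have hc := fun v => card_filter_le_eq_of_sum_pow_eq h v
  refine le_antisymm ?_ ?_
  · exact imp_of_card_filter_le (Q := fun j => p i ≤ p j) (P := fun j => p i ≤ q j)
      (fun a b hab hb => hb.trans (hq a b hab)) (fun a b hab hb => hb.trans (hp a b hab))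
      (hc _).le le_rfl
  · exact imp_of_card_filter_le (Q := fun j => q i ≤ q j) (P := fun j => q i ≤ p j)
      (fun a b hab hb => hb.trans (hp a b hab)) (fun a b hab hb => hb.trans (hq a b hab))
      (hc _).ge le_rfl

lemma card_support_le_of_maj {α : Type*} [Fintype α] {f g : α → ℝ}
    (hf : IsProbVec f) (hg : IsProbVec g) (h : Maj f g) :
    (univ.filter fun i => g i ≠ 0).card ≤ (univ.filter fun i => f i ≠ 0).card := by
  classical
  obtain ⟨T, hT, hT'⟩ := exists_maxSum_eq g (card_le_univ (univ.filter fun i => f i ≠ 0))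
  have h1 := sum_le_maxSum f (univ.filter fun i => f i ≠ 0)
  rw [sum_filter_ne_zero, hf.2] at h1
  have h2 : 1 ≤ ∑ i ∈ T, g i := hT' ▸ h1.trans (h.2 _)
  rw [← hT]
  refine card_le_card fun i hi => ?_
  by_contra hiT
  have h3 : ∑ j ∈ insert i T, g j ≤ ∑ j, g j :=
    sum_le_sum_of_subset_of_nonneg (subset_univ _) fun j _ _ => hg.1 j
  rw [sum_insert hiT, hg.2] at h3
  have h4 : g i ≠ 0 := by simpa using hi
  exact h4 (le_antisymm (by linarith) (hg.1 i))

lemma card_support_tensor {α β : Type*} [Fintype α] [Fintype β] (f : α → ℝ) (g : β → ℝ) :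
    (univ.filter fun x => tensor f g x ≠ 0).card =
      (univ.filter fun i => f i ≠ 0).card * (univ.filter fun j => g j ≠ 0).card := by
  rw [← card_product]
  congr 1
  ext x
  simp [tensor]

lemma necessity {d m₁ m₂ m₃ : ℕ} {p q : Fin d → ℝ} (hp : IsProbVec p) (hq : IsProbVec q)
    (hne : p ≠ q) (hpdec : ∀ i j : Fin d, i ≤ j → p j ≤ p i)
    (hqdec : ∀ i j : Fin d, i ≤ j → q j ≤ q i)
    {r : Fin m₁ × Fin m₂ × Fin m₃ → ℝ} (hr : IsProbVec r)
    (h : Maj (tensor p r) (tensor q (prodMarg r))) :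
    (univ.filter (fun i => q i ≠ 0)).card ≤ (univ.filter (fun i => p i ≠ 0)).card ∧
      shannon q < shannon p := by
  have hpr := hp.tensor hr
  have hqs := hq.tensor hr.prodMarg
  constructor
  · have h1 := card_support_le_of_maj hpr hqs h
    rw [card_support_tensor, card_support_tensor] at h1
    have h2 : (univ.filter fun x => r x ≠ 0).card ≤
        (univ.filter fun x => prodMarg r x ≠ 0).card := by
      refine card_le_card fun x => ?_
      simp only [mem_filter, mem_univ, true_and]
      exact mt fun hx => eq_zero_of_prodMarg_eq_zero hr (by simpa [prodMarg] using hx)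
    have h3 : 0 < (univ.filter fun x => r x ≠ 0).card := by
      refine Nat.pos_of_ne_zero fun h0 => ?_
      have := sum_filter_ne_zero (f := r) univ
      rw [card_eq_zero.1 h0, hr.2] at this
      simp at this
    exact Nat.le_of_mul_le_mul_right ((Nat.mul_le_mul_left _ h2).trans h1) h3
  · obtain ⟨h1, h2⟩ := shannon_le_of_hinge_le hpr hqs h.hinge_le
    obtain ⟨h3, h4⟩ := shannon_le_shannon_prodMarg hr
    rw [shannon_tensor hp hr, shannon_tensor hq hr.prodMarg] at h1 h2
    refine lt_of_le_of_ne (by linarith) fun heq => hne ?_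
    have hrs := h4 (by linarith)
    have hpow := h2 (by linarith)
    refine eq_of_sum_pow_eq hpdec hqdec fun m => ?_
    match m with
    | 0 => simp
    | 1 => simpa using hp.2.trans hq.2.symm
    | j + 2 =>
      have e := hpow j
      rw [← hrs] at e
      simp only [tensor, Fintype.sum_prod_type, mul_pow, ← mul_sum, ← sum_mul] at e
      have h5 : 0 < ∑ x, r x ^ (j + 2) := by
        obtain ⟨x, -, hx⟩ := exists_ne_zero_of_sum_ne_zero (by rw [hr.2]; norm_num :
          ∑ x, r x ≠ 0)
        exact sum_pos' (fun y _ => pow_nonneg (hr.1 y) _)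
          ⟨x, mem_univ x, pow_pos (lt_of_le_of_ne (hr.1 x) hx.symm) _⟩
      simp only [Fintype.sum_prod_type] at h5
      exact mul_right_cancel₀ h5.ne' e

/-! ### Typical sequences -/

/-- The `n`-fold tensor power of `f`. -/
def tensorPow {ι : Type*} (f : ι → ℝ) (n : ℕ) (x : Fin n → ι) : ℝ := ∏ j, f (x j)

/-- The number of occurrences of the letter `i` in `x`. -/
def occ {ι : Type*} [DecidableEq ι] {n : ℕ} (x : Fin n → ι) (i : ι) : ℝ :=
  ∑ j, if x j = i then 1 else 0

lemma occ_nonneg {ι : Type*} [DecidableEq ι] {n : ℕ} (x : Fin n → ι) (i : ι) : 0 ≤ occ x i :=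
  sum_nonneg fun j _ => by split_ifs <;> norm_num

lemma sum_occ {ι : Type*} [Fintype ι] [DecidableEq ι] {n : ℕ} (x : Fin n → ι) :
    ∑ i, occ x i = n := by
  simp only [occ]
  rw [sum_comm]
  simp

lemma sum_tensorPow {ι : Type*} [Fintype ι] (f : ι → ℝ) (n : ℕ) :
    ∑ x, tensorPow f n x = (∑ i, f i) ^ n := by
  rw [Fintype.sum_pow]
  rfl

lemma tensorPow_nonneg {ι : Type*} {f : ι → ℝ} (hf : ∀ i, 0 ≤ f i) (n : ℕ) (x : Fin n → ι) :
    0 ≤ tensorPow f n x := prod_nonneg fun _ _ => hf _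

lemma IsProbVec.tensorPow {ι : Type*} [Fintype ι] {f : ι → ℝ} (hf : IsProbVec f) (n : ℕ) :
    IsProbVec (tensorPow f n) :=
  ⟨tensorPow_nonneg hf.1 n, by rw [sum_tensorPow, hf.2, one_pow]⟩

lemma sum_tensorPow_mul_occ {ι : Type*} [Fintype ι] [DecidableEq ι] {f : ι → ℝ}
    (hf : ∑ i, f i = 1) (n : ℕ) (i : ι) : ∑ x, tensorPow f n x * occ x i = n * f i := by
  have h : ∀ j : Fin n, ∑ x, tensorPow f n x * (if x j = i then 1 else 0) = f i := by
    intro j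
    have e : ∀ x : Fin n → ι, tensorPow f n x * (if x j = i then 1 else 0) =
        ∏ k, (if k = j then (if x k = i then f i else 0) else f (x k)) := by
      intro x
      rw [tensorPow, ← mul_prod_erase univ _ (mem_univ j), ← mul_prod_erase univ (fun k =>
        if k = j then (if x k = i then f i else 0) else f (x k)) (mem_univ j)]
      rw [prod_congr rfl fun k (hk : k ∈ univ.erase j) => if_neg (ne_of_mem_erase hk)]
      by_cases hx : x j = i <;> simp [hx]
    rw [sum_congr rfl fun x _ => e x]
    have := (Finset.prod_univ_sum (fun _ : Fin n => (univ : Finset ι))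
      (fun k a => if k = j then (if a = i then f i else 0) else f a)).symm
    rw [Fintype.piFinset_univ] at this
    rw [this, ← mul_prod_erase univ _ (mem_univ j),
      prod_congr rfl fun k (hk : k ∈ univ.erase j) =>
        sum_congr rfl fun a _ => if_neg (ne_of_mem_erase hk)]
    simp [hf]
  simp only [occ, mul_sum]
  rw [sum_comm, sum_congr rfl fun j _ => h j]
  simp

/-- An exponential tail bound for sums of independent variables with negative mean. -/
lemma exists_tail_le_pow {ι : Type*} [Fintype ι] {f : ι → ℝ} (hf : IsProbVec f) {Y : ι → ℝ}
    (hY : ∑ i, f i * Y i < 0) : ∃ ρ : ℝ, 0 ≤ ρ ∧ ρ < 1 ∧ ∀ (n : ℕ) (B : Finset (Fin n → ι)),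
      (∀ x ∈ B, tensorPow f n x ≠ 0 → 0 ≤ ∑ j, Y (x j)) → ∑ x ∈ B, tensorPow f n x ≤ ρ ^ n := by
  set G : ℝ → ℝ := fun s => ∑ i, f i * Real.exp (s * Y i) with hG
  have hder : HasDerivAt G (∑ i, f i * Y i) 0 := by
    refine HasDerivAt.fun_sum fun i _ => ?_
    have := (((hasDerivAt_id (0 : ℝ)).mul_const (Y i)).exp).const_mul (f i)
    simpa using this
  have h0 : G 0 = 1 := by simp [hG, hf.2]
  obtain ⟨s, hs, hs1⟩ : ∃ s : ℝ, 0 < s ∧ G s < 1 := by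
    have h1 := (hasDerivAt_iff_tendsto_slope.1 hder).eventually_lt_const hY
    have h2 := h1.filter_mono (nhdsWithin_mono (0 : ℝ)
      (fun x (hx : x ∈ Set.Ioi (0 : ℝ)) => ne_of_gt hx))
    obtain ⟨s, hs, hs'⟩ := (h2.and self_mem_nhdsWithin).exists
    refine ⟨s, hs', ?_⟩
    rw [slope_def_field, h0, sub_zero] at hs
    have := (div_neg_iff.1 hs).resolve_left fun h => absurd h.2 (not_lt.2 (le_of_lt hs'))
    linarith [this.1]
  refine ⟨G s, sum_nonneg fun i _ => mul_nonneg (hf.1 i) (Real.exp_pos _).le, hs1, ?_⟩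
  intro n B hB
  have hnn : ∀ x : Fin n → ι, 0 ≤ tensorPow (fun i => f i * Real.exp (s * Y i)) n x :=
    tensorPow_nonneg (fun i => mul_nonneg (hf.1 i) (Real.exp_pos _).le) n
  calc ∑ x ∈ B, tensorPow f n x
      ≤ ∑ x ∈ B, tensorPow (fun i => f i * Real.exp (s * Y i)) n x := by
        refine sum_le_sum fun x hx => ?_
        by_cases hx0 : tensorPow f n x = 0
        · rw [hx0]
          exact hnn x
        · have e : tensorPow (fun i => f i * Real.exp (s * Y i)) n x =
              tensorPow f n x * Real.exp (s * ∑ j, Y (x j)) := by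
            simp only [tensorPow, prod_mul_distrib, mul_sum, Real.exp_sum]
          rw [e]
          exact le_mul_of_one_le_right (tensorPow_nonneg hf.1 n x)
            (Real.one_le_exp (mul_nonneg hs.le (hB x hx hx0)))
    _ ≤ ∑ x, tensorPow (fun i => f i * Real.exp (s * Y i)) n x :=
        sum_le_sum_of_subset_of_nonneg (subset_univ _) fun x _ _ => hnn x
    _ = G s ^ n := sum_tensorPow _ _

lemma log_tensorPow {ι : Type*} {f : ι → ℝ} {n : ℕ} {x : Fin n → ι} (hx : tensorPow f n x ≠ 0) :
    Real.log (tensorPow f n x) = ∑ j, Real.log (f (x j)) :=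
  Real.log_prod fun j _ => prod_ne_zero_iff.1 hx j (mem_univ j)

lemma exists_small_set_of_large_mass {ι : Type*} [Fintype ι] {f : ι → ℝ} (hf : IsProbVec f)
    {h : ℝ} (hh : shannon f < h) : ∃ ρ : ℝ, 0 ≤ ρ ∧ ρ < 1 ∧ ∀ n : ℕ, ∃ T : Finset (Fin n → ι),
      (T.card : ℝ) ≤ Real.exp (n * h) ∧ 1 - ρ ^ n ≤ ∑ x ∈ T, tensorPow f n x := by
  classical
  obtain ⟨ρ, h0, h1, hρ⟩ := exists_tail_le_pow hf (Y := fun i => -Real.log (f i) - h) (by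
    simp only [mul_sub, sum_sub_distrib, ← sum_mul, hf.2, mul_neg, sum_neg_distrib]
    simp only [shannon] at hh
    linarith)
  refine ⟨ρ, h0, h1, fun n => ?_⟩
  set T : Finset (Fin n → ι) := univ.filter fun x => Real.exp (-(n * h)) < tensorPow f n x
  have hmass := (hf.tensorPow n).2
  refine ⟨T, ?_, ?_⟩
  · have h2 : T.card * Real.exp (-(n * h)) ≤ 1 := by
      rw [← hmass, ← nsmul_eq_mul]
      refine (card_nsmul_le_sum T (tensorPow f n) _ fun x hx => ?_).trans
        (sum_le_sum_of_subset_of_nonneg (subset_univ _) fun x _ _ => tensorPow_nonneg hf.1 n x)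
      exact (mem_filter.1 hx).2.le
    rwa [Real.exp_neg, ← div_eq_mul_inv, div_le_one (Real.exp_pos _)] at h2
  · have h3 := hρ n Tᶜ fun x hx hx0 => by
      have h4 : tensorPow f n x ≤ Real.exp (-(n * h)) := by simpa [T] using hx
      have h5 := Real.log_le_log (lt_of_le_of_ne (tensorPow_nonneg hf.1 n x) hx0.symm) h4
      rw [Real.log_exp, log_tensorPow hx0] at h5
      simp only [sum_sub_distrib, sum_neg_distrib, sum_const, card_univ, Fintype.card_fin,
        nsmul_eq_mul]
      linarith
    linarith [sum_add_sum_compl T (tensorPow f n)]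

lemma exists_mass_of_large_weights_le {ι : Type*} [Fintype ι] {f : ι → ℝ} (hf : IsProbVec f)
    {h : ℝ} (hh : h < shannon f) : ∃ ρ : ℝ, 0 ≤ ρ ∧ ρ < 1 ∧
      ∀ (n : ℕ) (B : Finset (Fin n → ι)), (∀ x ∈ B, Real.exp (-(n * h)) < tensorPow f n x) →
        ∑ x ∈ B, tensorPow f n x ≤ ρ ^ n := by
  obtain ⟨ρ, h0, h1, hρ⟩ := exists_tail_le_pow hf (Y := fun i => Real.log (f i) + h) (by
    simp only [mul_add, sum_add_distrib, ← sum_mul, hf.2]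
    simp only [shannon] at hh
    linarith)
  refine ⟨ρ, h0, h1, fun n B hB => hρ n B fun x hx hx0 => ?_⟩
  have h5 := Real.log_le_log (Real.exp_pos _) (hB x hx).le
  rw [Real.log_exp, log_tensorPow hx0] at h5
  simp only [sum_add_distrib, sum_const, card_univ, Fintype.card_fin, nsmul_eq_mul]
  linarith

lemma hinge_le_of_flat {α : Type*} [Fintype α] {f g : α → ℝ} (hsum : ∑ i, f i = ∑ i, g i)
    {a b : ℝ} (hb : ∀ i, b ≤ f i) (ha : ∀ i, f i ≤ a) (T : Finset α)
    (hT : ∑ i, (f i - b) ≤ ∑ i ∈ T, g i - T.card * a) (t : ℝ) : hinge f t ≤ hinge g t := by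
  rcases le_or_gt a t with hat | hat
  · have h1 : hinge f t = 0 := sum_eq_zero fun i _ => max_eq_right (by linarith [ha i])
    rw [h1]
    exact sum_nonneg fun i _ => le_max_right _ _
  rcases le_or_gt t b with hbt | hbt
  · have h1 : hinge f t = ∑ i, (f i - t) :=
      sum_congr rfl fun i _ => max_eq_left (by linarith [hb i])
    rw [h1, sum_sub_distrib, hsum, ← sum_sub_distrib]
    exact sum_le_sum fun i _ => le_max_left _ _
  · have h1 : hinge f t ≤ ∑ i, (f i - b) :=
      sum_le_sum fun i _ => max_le (by linarith) (by linarith [hb i])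
    have h2 := sum_sub_card_mul_le_hinge g T t
    have h3 : (T.card : ℝ) * t ≤ T.card * a := by gcongr
    linarith

lemma isProbVec_uniform (α : Type*) [Fintype α] [Nonempty α] :
    IsProbVec fun _ : α => 1 / (Fintype.card α : ℝ) := by
  refine ⟨fun _ => by positivity, ?_⟩
  have : (Fintype.card α : ℝ) ≠ 0 := by exact_mod_cast Fintype.card_ne_zero
  simp [this]

lemma shannon_le_log_card {α : Type*} [Fintype α] [Nonempty α] {f : α → ℝ} (hf : IsProbVec f) :
    shannon f ≤ Real.log (Fintype.card α) := by
  have hc : (Fintype.card α : ℝ) ≠ 0 := by exact_mod_cast Fintype.card_ne_zero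
  have := (shannon_le_cross_entropy hf (isProbVec_uniform α)
    (fun i hi => absurd hi (one_div_ne_zero hc))).1
  simpa [← sum_mul, hf.2] using this

/-- A positive probability vector is a mixture of the uniform one, with small positive weight, and
one of nearly the same entropy. -/
lemma exists_mixture_of_lt_shannon {ι : Type*} [Fintype ι] [Nonempty ι] {p : ι → ℝ}
    (hp : IsProbVec p) (hpos : ∀ i, 0 < p i) {h : ℝ} (hh : h < shannon p) :
    ∃ (κ : ℝ) (w : ι → ℝ), 0 < κ ∧ 2 * κ < 1 ∧ IsProbVec w ∧ h < shannon w ∧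
      ∀ i, p i = (1 - 2 * κ) * w i + 2 * κ * (1 / Fintype.card ι) := by
  set w : ℝ → ι → ℝ := fun κ i => (p i - 2 * κ * (1 / Fintype.card ι)) / (1 - 2 * κ) with hw
  have hcont : ∀ i, ContinuousAt (fun κ => w κ i) 0 := by
    intro i
    refine ContinuousAt.div (by fun_prop) (by fun_prop) (by norm_num)
  have hw0 : w 0 = p := by
    funext i
    simp [hw]
  have h1 : ContinuousAt (fun κ => shannon (w κ)) 0 := by
    refine ContinuousAt.neg (tendsto_finsetSum _ fun i _ => ?_)
    exact Real.continuous_mul_log.continuousAt.comp (hcont i)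
  have e1 : ∀ᶠ κ in nhds (0 : ℝ), h < shannon (w κ) :=
    h1.eventually_const_lt (show h < shannon (w 0) by rwa [hw0])
  have e2 : ∀ᶠ κ in nhds (0 : ℝ), ∀ i, 0 < w κ i := by
    rw [Filter.eventually_all]
    exact fun i => (hcont i).eventually_const_lt (show 0 < w 0 i by rw [hw0]; exact hpos i)
  have e3 : ∀ᶠ κ in nhdsWithin (0 : ℝ) (Set.Ioi 0), κ ∈ Set.Ioo (0 : ℝ) (1 / 2) :=
    Ioo_mem_nhdsGT (by norm_num)
  obtain ⟨κ, ⟨hκ1, hκ2⟩, hκ3⟩ := (((e1.and e2).filter_mono nhdsWithin_le_nhds).and e3).exists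
  have hκ : 1 - 2 * κ ≠ 0 := by linarith [hκ3.2]
  refine ⟨κ, w κ, hκ3.1, by linarith [hκ3.2], ⟨fun i => (hκ2 i).le, ?_⟩, hκ1, fun i => ?_⟩
  · simp only [hw]
    rw [← sum_div, sum_sub_distrib, hp.2, ← mul_sum, (isProbVec_uniform ι).2, mul_one,
      div_self hκ]
  · simp only [hw]
    field_simp
    ring

/-- If every weight of `tensorPow w n` above `s` is removed and the missing mass is replaced by a
nearly uniform product distribution, the mean number of occurrences of each letter can be kept. -/
lemma exists_smoothing {ι : Type*} [Fintype ι] [Nonempty ι] [DecidableEq ι] {w : ι → ℝ}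
    (hw : IsProbVec w) {κ ε s : ℝ} (hκ : 0 < κ) (hκ1 : 2 * κ < 1) {n : ℕ} (hn : 0 < n)
    (hs : 0 ≤ s)
    (hε : ∑ x ∈ univ.filter (fun x => s ^ n < tensorPow w n x), tensorPow w n x ≤ ε)
    (hεs : 1 / Fintype.card ι + ε / κ ≤ s) :
    ∃ ξ : (Fin n → ι) → ℝ, (∀ x, 0 ≤ ξ x) ∧ ∑ x, ξ x = 1 - κ ∧
      (∀ i, ∑ x, ξ x * occ x i = n * ((1 - 2 * κ) * w i + κ * (1 / Fintype.card ι))) ∧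
      ∀ x, ξ x ≤ (1 + ε - κ) * s ^ n := by
  set d : ℝ := (Fintype.card ι : ℝ) with hd
  have hdpos : 0 < d := by rw [hd]; exact_mod_cast Fintype.card_pos
  have hn' : (0 : ℝ) < n := by exact_mod_cast hn
  set B : Finset (Fin n → ι) := univ.filter fun x => s ^ n < tensorPow w n x with hB
  have hwn := tensorPow_nonneg hw.1 n
  set δ : ℝ := ∑ x ∈ B, tensorPow w n x with hδ
  have hδ0 : 0 ≤ δ := sum_nonneg fun x _ => hwn x
  set A : ι → ℝ := fun i => (∑ x ∈ B, tensorPow w n x * occ x i) / n with hA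
  have hA0 : ∀ i, 0 ≤ A i := fun i =>
    div_nonneg (sum_nonneg fun x _ => mul_nonneg (hwn x) (occ_nonneg x i)) hn'.le
  have hAsum : ∑ i, A i = δ := by
    simp only [hA]
    rw [← sum_div, sum_comm]
    simp only [← mul_sum, sum_occ]
    rw [← sum_mul, mul_div_cancel_right₀ _ hn'.ne']
  have hAle : ∀ i, A i ≤ ε := fun i =>
    (single_le_sum (fun j _ => hA0 j) (mem_univ i)).trans (hAsum.le.trans hε)
  have hε0 : 0 ≤ ε := hδ0.trans hε
  set m : ℝ := κ + (1 - 2 * κ) * δ with hm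
  have hκm : κ ≤ m := by nlinarith
  have hm0 : 0 < m := hκ.trans_le hκm
  set g : ι → ℝ := fun i => (κ * (1 / d) + (1 - 2 * κ) * A i) / m with hg
  have hg0 : ∀ i, 0 ≤ g i := fun i =>
    div_nonneg (add_nonneg (by positivity) (mul_nonneg (by linarith) (hA0 i))) hm0.le
  have hgsum : ∑ i, g i = 1 := by
    simp only [hg]
    rw [← sum_div, sum_add_distrib, ← mul_sum, ← mul_sum, hAsum, (isProbVec_uniform ι).2, mul_one,
      div_self hm0.ne']
  have hmg : ∀ i, m * g i = κ * (1 / d) + (1 - 2 * κ) * A i := fun i => by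
    simp only [hg]
    field_simp
  have hgle : ∀ i, g i ≤ s := by
    intro i
    refine le_trans ?_ hεs
    rw [hg, div_le_iff₀ hm0]
    have h1 : (1 - 2 * κ) * A i ≤ ε := by nlinarith [hA0 i, hAle i]
    have h2 : (1 / d + ε / κ) * κ = κ * (1 / d) + ε := by field_simp
    have h3 : (1 / d + ε / κ) * κ ≤ (1 / d + ε / κ) * m := by gcongr
    linarith
  have hgn : ∀ x, tensorPow g n x ≤ s ^ n := by
    intro x
    refine (prod_le_prod (fun j _ => hg0 _) fun j _ => hgle (x j)).trans ?_
    simp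
  refine ⟨fun x => (1 - 2 * κ) * (if x ∈ B then 0 else tensorPow w n x) + m * tensorPow g n x,
    ?_, ?_, ?_, ?_⟩
  · intro x
    refine add_nonneg (mul_nonneg (by linarith) ?_)
      (mul_nonneg hm0.le (tensorPow_nonneg hg0 n x))
    split_ifs
    exacts [le_rfl, hwn x]
  · have h1 : ∑ x, (if x ∈ B then 0 else tensorPow w n x) = 1 - δ := by
      rw [← (hw.tensorPow n).2, hδ, eq_sub_iff_add_eq, ← sum_filter_add_sum_filter_not univ (· ∈ B)
        (tensorPow w n), add_comm, sum_ite, sum_const_zero, zero_add]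
      simp
    rw [sum_add_distrib, ← mul_sum, ← mul_sum, h1, sum_tensorPow, hgsum, hm]
    ring
  · intro i
    have h1 : ∑ x, (if x ∈ B then 0 else tensorPow w n x) * occ x i = n * w i - n * A i := by
      have e : n * A i = ∑ x ∈ B, tensorPow w n x * occ x i := by
        simp only [hA]
        field_simp
      rw [← sum_tensorPow_mul_occ hw.2, e, eq_sub_iff_add_eq,
        ← sum_filter_add_sum_filter_not univ (· ∈ B) (fun x => tensorPow w n x * occ x i), add_comm]
      simp only [ite_mul, zero_mul]
      rw [sum_ite, sum_const_zero, zero_add]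
      simp
    simp only [add_mul, sum_add_distrib, mul_assoc]
    rw [← mul_sum, ← mul_sum, h1, sum_tensorPow_mul_occ hgsum]
    linear_combination n * hmg i
  · intro x
    have h1 : (if x ∈ B then 0 else tensorPow w n x) ≤ s ^ n := by
      split_ifs with hx
      · positivity
      · simpa [hB] using hx
    have h2 : (1 - 2 * κ) * (if x ∈ B then 0 else tensorPow w n x) ≤ (1 - 2 * κ) * s ^ n := by
      gcongr
    have h3 : m * tensorPow g n x ≤ m * s ^ n := by
      gcongr
      exact hgn x
    have h4 : m ≤ κ + ε := by nlinarith
    have h5 : m * s ^ n ≤ (κ + ε) * s ^ n := by gcongr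
    calc _ ≤ (1 - 2 * κ) * s ^ n + (κ + ε) * s ^ n := by linarith
      _ = _ := by ring

/-- If `q` has smaller entropy than the positive vector `p`, some distribution whose average
one-letter marginal is exactly `p` is majorized by a tensor power of `q`. -/
lemma exists_average_marginal_eq {ι : Type*} [Fintype ι] [DecidableEq ι] {p q : ι → ℝ}
    (hp : IsProbVec p) (hq : IsProbVec q) (hpos : ∀ i, 0 < p i) (h : shannon q < shannon p) :
    ∃ (n : ℕ) (ξ : (Fin n → ι) → ℝ), 0 < n ∧ IsProbVec ξ ∧
      (∀ i, ∑ x, ξ x * occ x i = n * p i) ∧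
      ∀ t, hinge ξ t ≤ hinge (tensorPow q n) t := by
  have hne : Nonempty ι := by
    by_contra hemp
    rw [not_nonempty_iff] at hemp
    simpa using hp.2
  obtain ⟨κ, w, hκ, hκ1, hw, hqw, hpw⟩ := exists_mixture_of_lt_shannon hp hpos h
  obtain ⟨a, hqa, haw⟩ := exists_between hqw
  obtain ⟨b, hab, hbw⟩ := exists_between haw
  obtain ⟨ρ₁, h10, h11, hρ₁⟩ := exists_small_set_of_large_mass hq hqa
  obtain ⟨ρ₂, h20, h21, hρ₂⟩ := exists_mass_of_large_weights_le hw hbw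
  set d : ℝ := (Fintype.card ι : ℝ) with hd
  have hdpos : 0 < d := by rw [hd]; exact_mod_cast Fintype.card_pos
  set s : ℝ := Real.exp (-b) with hs
  have hspos : 0 < s := Real.exp_pos _
  have hds : 1 / d < s := by
    rw [hs, Real.exp_neg, ← one_div]
    refine one_div_lt_one_div_of_lt (Real.exp_pos _) ?_
    rw [← Real.lt_log_iff_exp_lt hdpos]
    exact hbw.trans_le (shannon_le_log_card hw)
  have hσ : Real.exp (a - b) < 1 := by
    rw [Real.exp_lt_one_iff]
    linarith
  have t1 := tendsto_pow_atTop_nhds_zero_of_lt_one h10 h11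
  have t2 := tendsto_pow_atTop_nhds_zero_of_lt_one h20 h21
  have t3 := tendsto_pow_atTop_nhds_zero_of_lt_one (Real.exp_pos (a - b)).le hσ
  have t4 : Filter.Tendsto (fun n : ℕ => ρ₁ ^ n + 2 * Real.exp (a - b) ^ n) Filter.atTop
      (nhds 0) := by
    simpa using t1.add (t3.const_mul 2)
  have t5 : Filter.Tendsto (fun n : ℕ => 1 / d + ρ₂ ^ n / κ) Filter.atTop (nhds (1 / d)) := by
    simpa using (t2.div_const κ).const_add (1 / d)
  obtain ⟨n, ⟨⟨e4, e5⟩, hn⟩⟩ := (((t4.eventually_lt_const hκ).and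
    (t5.eventually_lt_const hds)).and (Filter.eventually_gt_atTop 0)).exists
  have hsn : s ^ n = Real.exp (-(n * b)) := by
    rw [hs, ← Real.exp_nat_mul]
    congr 1
    ring
  obtain ⟨η, hη0, hηsum, hηocc, hηle⟩ := exists_smoothing hw hκ hκ1 hn
    hspos.le
    (hρ₂ n _ fun x hx => by rw [← hsn]; exact (mem_filter.1 hx).2) e5.le
  obtain ⟨T, hT, hTmass⟩ := hρ₁ n
  set u : ι → ℝ := fun _ => 1 / d with hu
  have huP : IsProbVec u := isProbVec_uniform ι
  have hun : ∀ x, tensorPow u n x = (1 / d) ^ n := fun x => by simp [tensorPow, hu]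
  have hsum : ∑ x, (η x + κ * tensorPow u n x) = 1 := by
    rw [sum_add_distrib, hηsum, ← mul_sum, (huP.tensorPow n).2]
    ring
  refine ⟨n, fun x => η x + κ * tensorPow u n x, hn, ⟨fun x => add_nonneg (hη0 x)
    (mul_nonneg hκ.le ((huP.tensorPow n).1 x)), hsum⟩, fun i => ?_, ?_⟩
  · simp only [add_mul, sum_add_distrib, mul_assoc]
    rw [hηocc, ← mul_sum, sum_tensorPow_mul_occ huP.2, hpw i]
    ring
  · refine hinge_le_of_flat (hsum.trans (hq.tensorPow n).2.symm) (a := 2 * s ^ n)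
      (b := κ * (1 / d) ^ n) (fun x => ?_) (fun x => ?_) T ?_
    · rw [hun]
      linarith [hη0 x]
    · rw [hun]
      have h1 : (1 / d) ^ n ≤ s ^ n := by gcongr
      have h2 : ρ₂ ^ n ≤ 1 := pow_le_one₀ h20 h21.le
      have h3 : κ * (1 / d) ^ n ≤ κ * s ^ n := by gcongr
      have h4 : ρ₂ ^ n * s ^ n ≤ 1 * s ^ n := by gcongr
      linarith [hηle x]
    · have h1 : (T.card : ℝ) * (2 * s ^ n) ≤ 2 * Real.exp (a - b) ^ n := by
        calc (T.card : ℝ) * (2 * s ^ n) ≤ Real.exp (n * a) * (2 * s ^ n) := by gcongr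
          _ = 2 * (Real.exp (n * a) * Real.exp (-(n * b))) := by rw [hsn]; ring
          _ = 2 * Real.exp (a - b) ^ n := by
            rw [← Real.exp_add, ← Real.exp_nat_mul]
            congr 2
            ring
      have h2 : ∑ x, (η x + κ * tensorPow u n x - κ * (1 / d) ^ n) = 1 - κ := by
        rw [← hηsum]
        exact sum_congr rfl fun x _ => by rw [hun]; ring
      rw [h2]
      linarith

/-! ### The catalyst -/

lemma hinge_const_mul {α : Type*} [Fintype α] {c : ℝ} (hc : 0 < c) (f : α → ℝ) (t : ℝ) :
    hinge (fun i => c * f i) t = c * hinge f (t / c) := by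
  simp only [hinge, mul_sum]
  refine sum_congr rfl fun i _ => ?_
  rw [mul_max_of_nonneg _ _ hc.le, mul_zero, mul_sub, mul_div_cancel₀ _ hc.ne']

/-- The marginal of `ξ` on the first `k` letters, completed by independent letters of law `q`. -/
noncomputable def hybrid {ι : Type*} [Fintype ι] [DecidableEq ι] {n : ℕ} (ξ : (Fin n → ι) → ℝ)
    (q : ι → ℝ) (k : ℕ) (x : Fin n → ι) : ℝ :=
  ∑ z, ξ z * ∏ i : Fin n, if (i : ℕ) < k then (if z i = x i then 1 else 0) else q (x i)

/-- The conditional law, given the word `z`, of the letters other than the `k`-th one in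
`hybrid ξ q k`. -/
def hybridKernel {ι : Type*} [DecidableEq ι] {n : ℕ} (q : ι → ℝ) (k : Fin (n + 1))
    (z : Fin (n + 1) → ι) (y : Fin n → ι) : ℝ :=
  ∏ j, if (k.succAbove j : ℕ) < k then (if z (k.succAbove j) = y j then 1 else 0) else q (y j)

lemma sum_hybridKernel {ι : Type*} [Fintype ι] [DecidableEq ι] {n : ℕ} {q : ι → ℝ}
    (hq : ∑ i, q i = 1) (k : Fin (n + 1)) (z : Fin (n + 1) → ι) :
    ∑ y, hybridKernel q k z y = 1 := by
  have := (Finset.prod_univ_sum (fun _ : Fin n => (univ : Finset ι)) (fun j a =>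
    if (k.succAbove j : ℕ) < k then (if z (k.succAbove j) = a then (1 : ℝ) else 0) else q a)).symm
  rw [Fintype.piFinset_univ] at this
  simp only [hybridKernel]
  rw [this]
  refine prod_eq_one fun j _ => ?_
  split_ifs <;> simp [hq]

lemma hybrid_zero {ι : Type*} [Fintype ι] [DecidableEq ι] {n : ℕ} {ξ : (Fin n → ι) → ℝ}
    (hξ : ∑ x, ξ x = 1) (q : ι → ℝ) : hybrid ξ q 0 = tensorPow q n := by
  funext x
  simp [hybrid, ← sum_mul, hξ, tensorPow]

lemma hybrid_self {ι : Type*} [Fintype ι] [DecidableEq ι] {n : ℕ} (ξ : (Fin n → ι) → ℝ)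
    (q : ι → ℝ) : hybrid ξ q n = ξ := by
  funext x
  simp only [hybrid, Fin.is_lt, if_true]
  rw [sum_eq_single x]
  · simp
  · intro z _ hz
    obtain ⟨i, hi⟩ := Function.ne_iff.1 hz
    rw [prod_eq_zero (mem_univ i) (if_neg hi), mul_zero]
  · simp

lemma hybrid_insertNth {ι : Type*} [Fintype ι] [DecidableEq ι] {n : ℕ}
    (ξ : (Fin (n + 1) → ι) → ℝ) (q : ι → ℝ) (k : Fin (n + 1)) (s : ι) (y : Fin n → ι) :
    hybrid ξ q k (k.insertNth s y) = q s * ∑ z, ξ z * hybridKernel q k z y := by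
  simp only [hybrid, mul_sum]
  refine sum_congr rfl fun z _ => ?_
  rw [Fin.prod_univ_succAbove _ k]
  simp only [lt_irrefl, if_false, Fin.insertNth_apply_same, Fin.insertNth_apply_succAbove,
    hybridKernel]
  ring

lemma hybrid_succ_insertNth {ι : Type*} [Fintype ι] [DecidableEq ι] {n : ℕ}
    (ξ : (Fin (n + 1) → ι) → ℝ) (q : ι → ℝ) (k : Fin (n + 1)) (s : ι) (y : Fin n → ι) :
    hybrid ξ q (k + 1) (k.insertNth s y) =
      ∑ z, ξ z * ((if z k = s then 1 else 0) * hybridKernel q k z y) := by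
  have h : ∀ j, (k.succAbove j : ℕ) < k + 1 ↔ (k.succAbove j : ℕ) < k := by
    intro j
    have := Fin.val_ne_of_ne (Fin.succAbove_ne k j)
    omega
  simp only [hybrid]
  refine sum_congr rfl fun z _ => ?_
  rw [Fin.prod_univ_succAbove _ k]
  simp only [Nat.lt_succ_self, if_true, Fin.insertNth_apply_same, Fin.insertNth_apply_succAbove,
    hybridKernel, h]

lemma hinge_eq_sum_insertNth {ι : Type*} [Fintype ι] {n : ℕ} (k : Fin (n + 1))
    (f : (Fin (n + 1) → ι) → ℝ) (t : ℝ) :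
    hinge f t = ∑ s, ∑ y, max (f (k.insertNth s y) - t) 0 := by
  rw [hinge, ← (Fin.insertNthEquiv (fun _ => ι) k).sum_comp, Fintype.sum_prod_type]
  rfl

lemma exists_correlated_catalyst.{u} {ι : Type u} [Fintype ι] [DecidableEq ι] {p q : ι → ℝ}
    (hp : IsProbVec p) (hq : IsProbVec q) (hpos : ∀ i, 0 < p i) (h : shannon q < shannon p) :
    ∃ (β : Type u) (_ : Fintype β) (σ : ι × β → ℝ), IsProbVec σ ∧
      (∀ s, ∑ b, σ (s, b) = p s) ∧
      ∀ t, hinge σ t ≤ hinge (tensor q fun b => ∑ s, σ (s, b)) t := by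
  obtain ⟨n', ξ, hn', hξ, hocc, hhinge⟩ := exists_average_marginal_eq hp hq hpos h
  obtain ⟨n, rfl⟩ : ∃ n, n' = n + 1 := ⟨n' - 1, by omega⟩
  set c : ℝ := 1 / ((n + 1 : ℕ) : ℝ) with hc
  have hcpos : 0 < c := by positivity
  have hhyb : ∀ k x, 0 ≤ hybrid ξ q k x := by
    intro k x
    refine sum_nonneg fun z _ => mul_nonneg (hξ.1 z) (prod_nonneg fun i _ => ?_)
    split_ifs
    exacts [zero_le_one, le_rfl, hq.1 _]
  set σ : ι × (Fin (n + 1) × (Fin n → ι)) → ℝ := fun x =>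
    c * hybrid ξ q (x.2.1 + 1) (x.2.1.insertNth x.1 x.2.2) with hσ
  have hmarg : ∀ s, ∑ b, σ (s, b) = p s := by
    intro s
    simp only [hσ, hybrid_succ_insertNth, Fintype.sum_prod_type, ← mul_sum]
    have e : ∀ k : Fin (n + 1),
        ∑ y, ∑ z, ξ z * ((if z k = s then 1 else 0) * hybridKernel q k z y) =
          ∑ z, ξ z * (if z k = s then 1 else 0) := by
      intro k
      rw [sum_comm]
      refine sum_congr rfl fun z _ => ?_
      rw [← mul_sum, ← mul_sum, sum_hybridKernel hq.2, mul_one]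
    rw [sum_congr rfl fun k _ => e k, sum_comm]
    simp only [← mul_sum]
    have := hocc s
    simp only [occ] at this
    rw [this, hc, ← mul_assoc, one_div_mul_cancel (by positivity), one_mul]
  have hcat : ∀ b : Fin (n + 1) × (Fin n → ι),
      ∑ s, σ (s, b) = c * ∑ z, ξ z * hybridKernel q b.1 z b.2 := by
    intro b
    simp only [hσ, hybrid_succ_insertNth, ← mul_sum]
    rw [sum_comm]
    simp
  refine ⟨Fin (n + 1) × (Fin n → ι), inferInstance, σ, ⟨fun x => mul_nonneg hcpos.le (hhyb _ _), ?_⟩, hmarg, fun t => ?_⟩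
  · rw [Fintype.sum_prod_type, sum_congr rfl fun s _ => hmarg s, hp.2]
  · set H : ℕ → ℝ := fun k => hinge (fun x => c * hybrid ξ q k x) t with hH
    have e1 : hinge σ t = ∑ k ∈ range (n + 1), H (k + 1) := by
      rw [← Fin.sum_univ_eq_sum_range (fun k => H (k + 1))]
      simp only [hH]
      rw [hinge, Fintype.sum_prod_type]
      simp only [Fintype.sum_prod_type]
      rw [sum_comm, sum_congr rfl fun k _ => ?_]
      rw [hinge_eq_sum_insertNth k]
    have e2 : hinge (tensor q fun b => ∑ s, σ (s, b)) t = ∑ k ∈ range (n + 1), H k := by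
      rw [← Fin.sum_univ_eq_sum_range H]
      rw [hinge, Fintype.sum_prod_type]
      simp only [Fintype.sum_prod_type]
      rw [sum_comm, sum_congr rfl fun k _ => ?_]
      simp only [hH]
      rw [hinge_eq_sum_insertNth k]
      simp only [tensor, hcat, hybrid_insertNth]
      refine sum_congr rfl fun s _ => sum_congr rfl fun y _ => ?_
      ring_nf
    have e3 : H (n + 1) ≤ H 0 := by
      simp only [hH, hinge_const_mul hcpos, hybrid_self, hybrid_zero hξ.2]
      gcongr
      exact hhinge _
    rw [e1, e2]
    have h1 := sum_range_succ H (n + 1)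
    have h2 := sum_range_succ' H (n + 1)
    linarith

/-! ### Sufficiency -/

lemma sum_subtype_support {α : Type*} [Fintype α] {p : α → ℝ} [DecidablePred fun i => p i ≠ 0]
    {F : α → ℝ} (hF : ∀ i, p i = 0 → F i = 0) : ∑ i : {i // p i ≠ 0}, F i = ∑ i, F i := by
  rw [← sum_subtype (univ.filter fun i => p i ≠ 0) (by simp) F]
  exact sum_filter_of_ne fun i _ hi hpi => hi (hF i hpi)

lemma sufficiency {d : ℕ} {p q : Fin d → ℝ} (hp : IsProbVec p) (hq : IsProbVec q)
    (hsupp : ∀ i, p i = 0 → q i = 0) (h : shannon q < shannon p) :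
    ∃ m₁ m₂ m₃ : ℕ, 1 ≤ m₁ ∧ 1 ≤ m₂ ∧ 1 ≤ m₃ ∧
      ∃ r : Fin m₁ × Fin m₂ × Fin m₃ → ℝ, IsProbVec r ∧
        Maj (tensor p r) (tensor q (prodMarg r)) := by
  classical
  set p' : {i // p i ≠ 0} → ℝ := fun i => p i with hp'
  set q' : {i // p i ≠ 0} → ℝ := fun i => q i with hq'
  have hpP : IsProbVec p' :=
    ⟨fun i => hp.1 i, by rw [← hp.2]; exact sum_subtype_support fun i hi => hi⟩
  have hqP : IsProbVec q' :=
    ⟨fun i => hq.1 i, by rw [← hq.2]; exact sum_subtype_support hsupp⟩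
  have hpos : ∀ i, 0 < p' i := fun i => lt_of_le_of_ne (hp.1 i) (Ne.symm i.2)
  have hsh : shannon q' < shannon p' := by
    have e1 : shannon p' = shannon p := congrArg Neg.neg
      (sum_subtype_support (F := fun i => p i * Real.log (p i)) fun i hi => by simp [hi])
    have e2 : shannon q' = shannon q := congrArg Neg.neg
      (sum_subtype_support (F := fun i => q i * Real.log (q i)) fun i hi => by simp [hsupp i hi])
    rwa [e1, e2]
  obtain ⟨β, _, σ, hσ, hmarg, hhinge⟩ := exists_correlated_catalyst hpP hqP hpos hsh
  set e₁ := Fintype.equivFin {i // p i ≠ 0}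
  set e₂ := Fintype.equivFin β
  obtain ⟨x, -, hx⟩ := exists_ne_zero_of_sum_ne_zero (by rw [hσ.2]; norm_num : ∑ x, σ x ≠ 0)
  set r : Fin (Fintype.card {i // p i ≠ 0}) ×
      Fin (Fintype.card β) × Fin 1 → ℝ :=
    fun x => σ (e₁.symm x.1, e₂.symm x.2.1) with hr
  have hsum : ∀ F : {i // p i ≠ 0} → β → ℝ,
      ∑ x : Fin (Fintype.card {i // p i ≠ 0}) ×
        Fin (Fintype.card β) × Fin 1,
        F (e₁.symm x.1) (e₂.symm x.2.1) = ∑ a, ∑ b, F a b := by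
    intro F
    simp only [Fintype.sum_prod_type, univ_unique, sum_singleton]
    rw [e₁.symm.sum_comp fun a => ∑ j, F a (e₂.symm j)]
    exact sum_congr rfl fun a _ => e₂.symm.sum_comp fun b => F a b
  have hrP : IsProbVec r := by
    exact ⟨fun x => hσ.1 _,
      (hsum fun a b => σ (a, b)).trans ((Fintype.sum_prod_type σ).symm.trans hσ.2)⟩
  have hm : ∀ x, prodMarg r x = p' (e₁.symm x.1) * ∑ a, σ (a, e₂.symm x.2.1) := by
    intro x
    have m1 : marg₁ r x.1 = p' (e₁.symm x.1) := by
      simp only [marg₁, hr, univ_unique, sum_singleton, ← hmarg]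
      exact e₂.symm.sum_comp fun b => σ (e₁.symm x.1, b)
    have m2 : marg₂ r x.2.1 = ∑ a, σ (a, e₂.symm x.2.1) := by
      simp only [marg₂, hr, univ_unique, sum_singleton]
      exact e₁.symm.sum_comp fun a => σ (a, e₂.symm x.2.1)
    have m3 : marg₃ r x.2.2 = 1 := by
      rw [← hrP.marg₃.2]
      simp [Subsingleton.elim x.2.2 0]
    rw [prodMarg, m1, m2, m3, mul_one]
  refine ⟨_, _, 1, Fintype.card_pos_iff.2 ⟨x.1⟩, Fintype.card_pos_iff.2 ⟨x.2⟩, le_rfl, r, hrP,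
    maj_of_hinge_le ((hp.tensor hrP).2.trans (hq.tensor hrP.prodMarg).2.symm)
      (hq.tensor hrP.prodMarg).1 fun t ht => ?_⟩
  have e1 : hinge (tensor p r) t = ∑ i, hinge (fun x => p' i * σ x) t := by
    rw [hinge, Fintype.sum_prod_type]
    simp only [tensor, hr]
    rw [sum_congr rfl fun i _ => hsum fun a b => max (p i * σ (a, b) - t) 0]
    rw [← sum_subtype_support (p := p) fun i hi => by simp [hi, ht]]
    simp only [hinge, Fintype.sum_prod_type, hp']
  have e2 : hinge (tensor q (prodMarg r)) t =
      ∑ a, hinge (fun x => p' a * tensor q' (fun b => ∑ s, σ (s, b)) x) t := by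
    rw [hinge, Fintype.sum_prod_type]
    simp only [tensor, hm]
    rw [sum_congr rfl fun i _ =>
      hsum fun a b => max (q i * (p' a * ∑ s, σ (s, b)) - t) 0]
    rw [← sum_subtype_support (p := p) fun i hi => by simp [hsupp i hi, ht], sum_comm]
    simp only [hinge, Fintype.sum_prod_type, hq', mul_left_comm]
  rw [e1, e2]
  refine sum_le_sum fun i _ => ?_
  rw [hinge_const_mul (hpos i), hinge_const_mul (hpos i)]
  exact mul_le_mul_of_nonneg_left (hhinge _) (hpos i).le

/-- Criterion for entanglement assisted coherence transformations: a correlated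
ancilla whose marginals are returned unchanged enables the conversion iff the
number of nonzero entries does not increase and the Shannon entropy strictly
decreases. -/
theorem entanglement_assisted_conversion_iff
    (d : ℕ) (p q : Fin d → ℝ) (hp : IsProbVec p) (hq : IsProbVec q) (hne : p ≠ q)
    (hpdec : ∀ i j : Fin d, i ≤ j → p j ≤ p i)
    (hqdec : ∀ i j : Fin d, i ≤ j → q j ≤ q i) :
    (∃ m₁ m₂ m₃ : ℕ, 1 ≤ m₁ ∧ 1 ≤ m₂ ∧ 1 ≤ m₃ ∧
      ∃ r : Fin m₁ × Fin m₂ × Fin m₃ → ℝ, IsProbVec r ∧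
        Maj (tensor p r) (tensor q (prodMarg r)))
    ↔ ((Finset.univ.filter (fun i => q i ≠ 0)).card ≤
        (Finset.univ.filter (fun i => p i ≠ 0)).card ∧
       shannon q < shannon p) := by
  constructor
  · rintro ⟨m₁, m₂, m₃, -, -, -, r, hr, h⟩
    exact necessity hp hq hne hpdec hqdec hr h
  · rintro ⟨hcard, hsh⟩
    refine sufficiency hp hq (fun i hpi => ?_) hsh
    by_contra hqi
    have hpos : ∀ {f : Fin d → ℝ}, IsProbVec f → (∀ i j : Fin d, i ≤ j → f j ≤ f i) →
        ∀ i j, i ≤ j → f j ≠ 0 → f i ≠ 0 := fun hf hdec i j hij hj hi =>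
      hj (le_antisymm (hi ▸ hdec i j hij) (hf.1 j))
    exact imp_of_card_filter_le (hpos hp hpdec) (hpos hq hqdec) hcard hqi hpi
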